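/- Let p be a probability distribution on ℕ×ℕ whose first marginal p₁ has at most m nonzero entries (m ≥ 1). Then the mutual information I(p) is finite (indeed I(p) ≤ ln m), and for every probability distribution q on ℕ×ℕ and every ε ∈ (0,1] with TV(p,q) ≤ ε one has I(p) − I(q) ≤ ε·ln m + 2·g(ε), where I(q) is taken in [0,+∞] and the inequality is read in the extended reals. No constraint is imposed on q other than TV(p,q) ≤ ε. -/

import Mathlib

open scoped ENNReal

/-- `p` is a probability distribution on `α`: nonnegative entries summing to `1`. -/
def IsProbDist {α : Type*} (p : α → ℝ) : Prop := (∀ x, 0 ≤ p x) ∧ HasSum p 1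

/-- Extended-real-valued Shannon entropy `H(r) = ∑ η(r i) ∈ [0,+∞]`,
where `η(x) = −x ln x`. -/
noncomputable def shEnt (r : ℕ → ℝ) : ℝ≥0∞ :=
  ∑' i, ENNReal.ofReal (Real.negMulLog (r i))

/-- Total variation distance `TV(p,q) = (1/2)·∑ |p x − q x|`. -/
noncomputable def TVd {α : Type*} (p q : α → ℝ) : ℝ := (1 / 2) * ∑' x, |p x - q x|

/-- `g(x) = (x+1)·ln(x+1) − x·ln x` (with `g(0) = 0`, as `Real.log 0 = 0`). -/
noncomputable def gFun (x : ℝ) : ℝ := (x + 1) * Real.log (x + 1) - x * Real.log x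

/-- First marginal `p₁(i) = ∑_j p(i,j)`. -/
noncomputable def marg1 (p : ℕ × ℕ → ℝ) (i : ℕ) : ℝ := ∑' j, p (i, j)

/-- Second marginal `p₂(j) = ∑_i p(i,j)`. -/
noncomputable def marg2 (p : ℕ × ℕ → ℝ) (j : ℕ) : ℝ := ∑' i, p (i, j)

/-- Conditional Shannon entropy
`H(X₁|X₂)_p = ∑_{j : p₂(j) > 0} p₂(j)·H(p(·|j)) ∈ [0,+∞]`
(terms with `p₂(j) = 0` contribute `0`, since `0·∞ = 0` in `ℝ≥0∞` and division
by zero gives the zero distribution). -/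
noncomputable def condEnt (p : ℕ × ℕ → ℝ) : ℝ≥0∞ :=
  ∑' j, ENNReal.ofReal (marg2 p j) * shEnt fun i => p (i, j) / marg2 p j

/-- The summand `p(i,j)·ln(p(i,j)/(p₁(i)·p₂(j)))` of the mutual information,
with zero entries contributing `0`. -/
noncomputable def miTerm (p : ℕ × ℕ → ℝ) (x : ℕ × ℕ) : ℝ :=
  if p x = 0 then 0 else p x * Real.log (p x / (marg1 p x.1 * marg2 p x.2))

open Classical in
/-- Mutual information `I(p) = ∑_{i,j} p(i,j)·ln(p(i,j)/(p₁(i)·p₂(j)))`, valued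
in `[0,+∞]` (inside `EReal`): since the negative parts of the summands are
always summable, the sum is declared `+∞` precisely when the terms are not
summable. -/
noncomputable def mutInf (p : ℕ × ℕ → ℝ) : EReal :=
  if Summable (miTerm p) then ((∑' x, miTerm p x : ℝ) : EReal) else ⊤

lemma Real.log_le_log_add_div_sub_one {s t : ℝ} (hs : 0 < s) (ht : 0 < t) :
    Real.log s ≤ Real.log t + s / t - 1 := by
  have h := Real.log_le_sub_one_of_pos (div_pos hs ht)
  rw [Real.log_div hs.ne' ht.ne'] at h
  linarith

lemma Real.mul_log_le_mul_log_div_add {a c t : ℝ} (ha : 0 ≤ a) (hc : 0 ≤ c)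
    (hac : 0 < a → 0 < c) (ht : 0 < t) :
    a * Real.log t ≤ a * Real.log (a / c) + c * t - a := by
  rcases ha.eq_or_lt with rfl | ha
  · simpa using mul_nonneg hc ht.le
  · have hc := hac ha
    have h := mul_le_mul_of_nonneg_left
      (Real.log_le_log_add_div_sub_one ht (div_pos ha hc)) ha.le
    have e : a * (t / (a / c)) = c * t := by field_simp
    linarith

lemma gFun_monotoneOn : MonotoneOn gFun (Set.Ici 0) := by
  refine monotoneOn_of_deriv_nonneg (convex_Ici 0) ?_ ?_ ?_
  · exact ((Real.continuous_mul_log.comp (continuous_id.add continuous_const)).sub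
      Real.continuous_mul_log).continuousOn
  · intro x hx
    rw [interior_Ici] at hx
    have hx : 0 < x := hx
    unfold gFun
    have h1 : x + 1 ≠ 0 := by positivity
    have h2 : x ≠ 0 := hx.ne'
    apply DifferentiableAt.differentiableWithinAt
    fun_prop (disch := assumption)
  · intro x hx
    rw [interior_Ici] at hx
    have hx : 0 < x := hx
    have h1 : HasDerivAt (fun y : ℝ => (y + 1) * Real.log (y + 1))
        (Real.log (x + 1) + 1) x :=
      (Real.hasDerivAt_mul_log (by positivity : x + 1 ≠ 0)).comp_add_const x 1
    have h2 : HasDerivAt gFun _ x := h1.sub (Real.hasDerivAt_mul_log hx.ne')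
    rw [h2.deriv]
    have := Real.log_le_log hx (by linarith : x ≤ x + 1)
    linarith

lemma gFun_zero : gFun 0 = 0 := by simp [gFun]

lemma gFun_nonneg {x : ℝ} (hx : 0 ≤ x) : 0 ≤ gFun x :=
  gFun_zero ▸ gFun_monotoneOn (Set.mem_Ici.2 le_rfl) hx hx

section Marginals

variable {a b : ℕ × ℕ → ℝ} {A B : ℝ}

lemma marg2_eq_marg1_swap (a : ℕ × ℕ → ℝ) : marg2 a = marg1 (a ∘ Prod.swap) := rfl

lemma HasSum.comp_prodSwap (h : HasSum a A) : HasSum (a ∘ Prod.swap) A :=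
  (Equiv.prodComm ℕ ℕ).hasSum_iff.2 h

lemma hasSum_marg1 (h : HasSum a A) : HasSum (marg1 a) A :=
  h.prod_fiberwise fun i => (h.summable.prod_factor i).hasSum

lemma hasSum_marg2 (h : HasSum a A) : HasSum (marg2 a) A :=
  hasSum_marg1 h.comp_prodSwap

lemma marg1_nonneg (ha : ∀ x, 0 ≤ a x) (i : ℕ) : 0 ≤ marg1 a i :=
  tsum_nonneg fun _ => ha _

lemma marg2_nonneg (ha : ∀ x, 0 ≤ a x) (j : ℕ) : 0 ≤ marg2 a j :=
  tsum_nonneg fun _ => ha _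

lemma le_marg1 (ha : ∀ x, 0 ≤ a x) (h : Summable a) (x : ℕ × ℕ) : a x ≤ marg1 a x.1 :=
  (h.prod_factor x.1).le_tsum x.2 fun _ _ => ha _

lemma le_marg2 (ha : ∀ x, 0 ≤ a x) (h : Summable a) (x : ℕ × ℕ) : a x ≤ marg2 a x.2 :=
  le_marg1 (a := a ∘ Prod.swap) (fun _ => ha _) h.hasSum.comp_prodSwap.summable x.swap

lemma marg1_add (ha : Summable a) (hb : Summable b) (i : ℕ) :
    marg1 (a + b) i = marg1 a i + marg1 b i :=
  (ha.prod_factor i).tsum_add (hb.prod_factor i)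

lemma marg2_add (ha : Summable a) (hb : Summable b) (j : ℕ) :
    marg2 (a + b) j = marg2 a j + marg2 b j :=
  marg1_add ha.hasSum.comp_prodSwap.summable hb.hasSum.comp_prodSwap.summable j

lemma marg1_mono (hab : ∀ x, a x ≤ b x) (ha : Summable a) (hb : Summable b) (i : ℕ) :
    marg1 a i ≤ marg1 b i :=
  (ha.prod_factor i).tsum_le_tsum (fun _ => hab _) (hb.prod_factor i)

lemma hasSum_marg1_mul_marg2 (ha : ∀ x, 0 ≤ a x) (h : HasSum a A) :
    HasSum (fun x : ℕ × ℕ => marg1 a x.1 * marg2 a x.2) (A * A) :=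
  (hasSum_marg1 h).mul (hasSum_marg2 h) <|
    (hasSum_marg1 h).summable.mul_of_nonneg (hasSum_marg2 h).summable
      (marg1_nonneg ha) (marg2_nonneg ha)

/-- Redistributing a weight `w` on the first coordinate along the conditional
distributions of `a` does not increase its total mass. -/
lemma summable_div_marg1_mul (ha : ∀ x, 0 ≤ a x) (h : Summable a)
    {w : ℕ → ℝ} {W : ℝ} (hw : ∀ i, 0 ≤ w i) (hW : HasSum w W) :
    Summable (fun x : ℕ × ℕ => a x / marg1 a x.1 * w x.1) ∧
      ∑' x : ℕ × ℕ, a x / marg1 a x.1 * w x.1 ≤ W := by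
  have hfib (i : ℕ) : HasSum (fun j => a (i, j) / marg1 a i * w i)
      (marg1 a i / marg1 a i * w i) :=
    ((h.prod_factor i).hasSum.div_const _).mul_right _
  have hle (i : ℕ) : marg1 a i / marg1 a i * w i ≤ w i :=
    mul_le_of_le_one_left (hw i) (div_self_le_one _)
  have hsum : Summable fun i => marg1 a i / marg1 a i * w i :=
    hW.summable.of_nonneg_of_le (fun i => mul_nonneg
      (div_nonneg (marg1_nonneg ha i) (marg1_nonneg ha i)) (hw i)) hle
  have hs : Summable (fun x : ℕ × ℕ => a x / marg1 a x.1 * w x.1) := by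
    rw [summable_prod_of_nonneg
      fun x => mul_nonneg (div_nonneg (ha x) (marg1_nonneg ha _)) (hw _)]
    exact ⟨fun i => (hfib i).summable, by simpa only [(hfib _).tsum_eq] using hsum⟩
  refine ⟨hs, ?_⟩
  rw [hs.tsum_prod, ← hW.tsum_eq]
  simp only [(hfib _).tsum_eq]
  exact hsum.tsum_le_tsum hle hW.summable

/-- Cross-entropy bound: `∑ a ln(w(i)/a₁(i))` is at most `A ln(W/A)`, in the form of a
summable pointwise majorant. -/
lemma exists_majorant_log_div_marg1 (ha : ∀ x, 0 ≤ a x) (h : HasSum a A) (hA : 0 < A)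
    {w : ℕ → ℝ} {W : ℝ} (hw : ∀ i, 0 ≤ w i) (hW : HasSum w W) (hW0 : 0 < W)
    (hpos : ∀ x, 0 < a x → 0 < w x.1) :
    ∃ f : ℕ × ℕ → ℝ, Summable f ∧ ∑' x, f x ≤ A * Real.log (W / A) ∧
      ∀ x, a x * Real.log (w x.1 / marg1 a x.1) ≤ f x := by
  obtain ⟨hs, hle⟩ := summable_div_marg1_mul ha h.summable hw hW
  have hf := ((h.mul_right (Real.log (W / A))).add (hs.hasSum.mul_right (A / W))).sub h
  refine ⟨_, hf.summable, ?_, fun x => ?_⟩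
  · rw [hf.tsum_eq]
    have := mul_le_mul_of_nonneg_right hle (div_pos hA hW0).le
    have e : W * (A / W) = A := by field_simp
    linarith
  · rcases (ha x).eq_or_lt with h0 | h0
    · simp [← h0]
    · have h1 : 0 < marg1 a x.1 := h0.trans_le (le_marg1 ha h.summable x)
      have := mul_le_mul_of_nonneg_left (Real.log_le_log_add_div_sub_one
        (div_pos (hpos x h0) h1) (div_pos hW0 hA)) (ha x)
      have e : a x * (w x.1 / marg1 a x.1 / (W / A))
          = a x / marg1 a x.1 * w x.1 * (A / W) := by field_simp
      linarith

end Marginals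

section MutualInformation

variable {a b : ℕ × ℕ → ℝ} {A B : ℝ}

lemma miTerm_eq (a : ℕ × ℕ → ℝ) (x : ℕ × ℕ) :
    miTerm a x = a x * Real.log (a x / (marg1 a x.1 * marg2 a x.2)) := by
  unfold miTerm
  split_ifs with h <;> simp [h]

lemma marg1_mul_marg2_pos (ha : ∀ x, 0 ≤ a x) (h : Summable a) {x : ℕ × ℕ} (hx : 0 < a x) :
    0 < marg1 a x.1 * marg2 a x.2 :=
  mul_pos (hx.trans_le (le_marg1 ha h x)) (hx.trans_le (le_marg2 ha h x))

lemma mul_log_le_miTerm (ha : ∀ x, 0 ≤ a x) (h : Summable a) {t : ℝ} (ht : 0 < t)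
    (x : ℕ × ℕ) :
    a x * Real.log t ≤ miTerm a x + marg1 a x.1 * marg2 a x.2 * t - a x := by
  rw [miTerm_eq]
  exact Real.mul_log_le_mul_log_div_add (ha x)
    (mul_nonneg (marg1_nonneg ha _) (marg2_nonneg ha _))
    (marg1_mul_marg2_pos ha h) ht

lemma summable_miTerm_of_le (ha : ∀ x, 0 ≤ a x) (h : Summable a) {f : ℕ × ℕ → ℝ}
    (hf : Summable f) (hle : ∀ x, miTerm a x ≤ f x) : Summable (miTerm a) := by
  have hl := (hasSum_marg1_mul_marg2 ha h.hasSum).summable.sub h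
  have hpos : Summable fun x => miTerm a x + (marg1 a x.1 * marg2 a x.2 - a x) := by
    refine (hf.add hl).of_nonneg_of_le (fun x => ?_) fun x => by linarith [hle x]
    have := mul_log_le_miTerm ha h one_pos x
    rw [Real.log_one] at this
    linarith
  simpa using hpos.sub hl

lemma neg_mul_log_le_tsum_miTerm (ha : ∀ x, 0 ≤ a x) (h : HasSum a A) (hA : 0 < A)
    (hs : Summable (miTerm a)) : -(A * Real.log A) ≤ ∑' x, miTerm a x := by
  have h1 := h.mul_right (Real.log A⁻¹)
  have h2 := (hs.hasSum.add ((hasSum_marg1_mul_marg2 ha h).mul_right A⁻¹)).sub h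
  have := hasSum_le (mul_log_le_miTerm ha h.summable (inv_pos.2 hA)) h1 h2
  rw [Real.log_inv, mul_assoc A A, mul_inv_cancel₀ hA.ne'] at this
  linarith

lemma miTerm_add_le (ha : ∀ x, 0 ≤ a x) (hb : ∀ x, 0 ≤ b x) (hsa : Summable a)
    (hsb : Summable b) (x : ℕ × ℕ) : miTerm (a + b) x ≤ miTerm a x + miTerm b x := by
  rcases (add_nonneg (ha x) (hb x)).eq_or_lt with h0 | h0
  · have h1 : a x = 0 := by linarith [ha x, hb x]
    have h2 : b x = 0 := by linarith [ha x, hb x]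
    simp [miTerm, h1, h2]
  · have hr := marg1_mul_marg2_pos (a := a + b) (fun y => add_nonneg (ha y) (hb y))
      (hsa.add hsb) h0
    have ht := div_pos h0 hr
    have h1 := mul_log_le_miTerm ha hsa ht x
    have h2 := mul_log_le_miTerm hb hsb ht x
    rw [miTerm_eq (a + b)]
    simp only [Pi.add_apply] at *
    rw [marg1_add hsa hsb, marg2_add hsa hsb] at *
    have a1 := marg1_nonneg ha x.1
    have a2 := marg2_nonneg ha x.2
    have b1 := marg1_nonneg hb x.1
    have b2 := marg2_nonneg hb x.2
    set M := (marg1 a x.1 + marg1 b x.1) * (marg2 a x.2 + marg2 b x.2) with hM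
    have key : (marg1 a x.1 * marg2 a x.2 + marg1 b x.1 * marg2 b x.2) * ((a x + b x) / M)
        ≤ M * ((a x + b x) / M) := by
      gcongr
      rw [hM]
      nlinarith [mul_nonneg a1 b2, mul_nonneg b1 a2]
    rw [mul_div_cancel₀ _ hr.ne'] at key
    linarith

/-- The mutual information sum is superadditive up to twice the entropy of mixing. -/
lemma tsum_miTerm_add_tsum_miTerm_le (ha : ∀ x, 0 ≤ a x) (hb : ∀ x, 0 ≤ b x)
    (hsa : HasSum a A) (hsb : HasSum b B) (hA : 0 < A) (hB : 0 < B)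
    (hs : Summable (miTerm (a + b))) (hma : Summable (miTerm a)) :
    Summable (miTerm b) ∧ ∑' x, miTerm a x + ∑' x, miTerm b x ≤ ∑' x, miTerm (a + b) x +
      2 * (A * Real.log ((A + B) / A) + B * Real.log ((A + B) / B)) := by
  have hr : ∀ x, 0 ≤ (a + b) x := fun x => add_nonneg (ha x) (hb x)
  have hsr : HasSum (a + b) (A + B) := hsa.add hsb
  have hR : 0 < A + B := add_pos hA hB
  have main : ∀ {c : ℕ × ℕ → ℝ} {C : ℝ}, (∀ x, 0 ≤ c x) → HasSum c C → 0 < C →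
      (∀ x, c x ≤ (a + b) x) → ∃ f : ℕ × ℕ → ℝ, Summable f ∧
        ∑' x, f x ≤ 2 * (C * Real.log ((A + B) / C)) ∧ ∀ x, miTerm c x ≤
          c x * Real.log ((a + b) x / (marg1 (a + b) x.1 * marg2 (a + b) x.2)) + f x := by
    intro c C hc hsc hC hle
    obtain ⟨f, hf, hfl, hfx⟩ := exists_majorant_log_div_marg1 hc hsc hC
      (marg1_nonneg hr) (hasSum_marg1 hsr) hR
      (fun x hx => (hx.trans_le (hle x)).trans_le (le_marg1 hr hsr.summable x))
    obtain ⟨g, hg, hgl, hgx⟩ := exists_majorant_log_div_marg1 (a := c ∘ Prod.swap)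
      (fun _ => hc _) hsc.comp_prodSwap hC
      (marg2_nonneg hr) (hasSum_marg2 hsr) hR
      (fun x hx => (hx.trans_le (hle x.swap)).trans_le (le_marg2 hr hsr.summable x.swap))
    have hg' := hg.hasSum.comp_prodSwap
    refine ⟨fun x => f x + g x.swap, hf.add hg'.summable, ?_, fun x => ?_⟩
    · have := (hf.hasSum.add hg').tsum_eq
      simp only [Function.comp_apply] at this
      rw [this]
      linarith
    · have h1 := hfx x
      have h2 := hgx x.swap
      rw [← marg2_eq_marg1_swap] at h2
      simp only [Function.comp_apply, Prod.swap_swap, Prod.fst_swap] at h2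
      rw [miTerm_eq]
      rcases (hc x).eq_or_lt with h0 | h0
      · simp only [← h0, zero_mul] at *
        linarith
      · have c1 := h0.trans_le (le_marg1 hc hsc.summable x)
        have c2 := h0.trans_le (le_marg2 hc hsc.summable x)
        have r0 := h0.trans_le (hle x)
        have r1 := r0.trans_le (le_marg1 hr hsr.summable x)
        have r2 := r0.trans_le (le_marg2 hr hsr.summable x)
        have hlog := mul_le_mul_of_nonneg_left (Real.log_le_log h0 (hle x)) h0.le
        rw [Real.log_div r1.ne' c1.ne'] at h1
        rw [Real.log_div r2.ne' c2.ne'] at h2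
        rw [Real.log_div h0.ne' (mul_pos c1 c2).ne', Real.log_div r0.ne' (mul_pos r1 r2).ne',
          Real.log_mul c1.ne' c2.ne', Real.log_mul r1.ne' r2.ne']
        linarith
  obtain ⟨f, hf, hfl, hfx⟩ := main ha hsa hA fun x => le_add_of_nonneg_right (hb x)
  obtain ⟨g, hg, hgl, hgx⟩ := main hb hsb hB fun x => le_add_of_nonneg_left (ha x)
  have hle : ∀ x, miTerm a x + miTerm b x ≤ miTerm (a + b) x + (f x + g x) := fun x => by
    have h1 := hfx x
    have h2 := hgx x
    rw [miTerm_eq (a + b), show (a + b) x = a x + b x from rfl] at *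
    linarith
  have hmb : Summable (miTerm b) := summable_miTerm_of_le hb hsb.summable
    ((hs.add (hf.add hg)).sub hma) fun x => by linarith [hle x]
  refine ⟨hmb, ?_⟩
  have := hasSum_le hle (hma.hasSum.add hmb.hasSum)
    (hs.hasSum.add (hf.hasSum.add hg.hasSum))
  linarith

lemma tsum_miTerm_le_of_encard_support_le (ha : ∀ x, 0 ≤ a x) (h : HasSum a A) (hA : 0 < A)
    {m : ℕ} (hm : 1 ≤ m) (hsupp : (Function.support (marg1 a)).encard ≤ m) :
    Summable (miTerm a) ∧ ∑' x, miTerm a x ≤ A * Real.log m - A * Real.log A := by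
  have hfin : (Function.support (marg1 a)).Finite := Set.finite_of_encard_le_coe hsupp
  set S := hfin.toFinset with hS
  have hmem (i : ℕ) : i ∈ S ↔ marg1 a i ≠ 0 := by simp [hS]
  have hm0 : (0 : ℝ) < m := by exact_mod_cast hm
  have hcard : S.card ≤ m := by
    rw [hfin.encard_eq_coe_toFinset_card] at hsupp
    exact_mod_cast hsupp
  have hW : HasSum (fun i => if i ∈ S then (1 : ℝ) else 0) S.card := by
    have : HasSum (fun i => if i ∈ S then (1 : ℝ) else 0) _ :=
      hasSum_sum_of_ne_finset_zero (s := S) fun i hi => if_neg hi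
    simpa using this
  have hin : ∀ x, 0 < a x → x.1 ∈ S := fun x hx =>
    (hmem _).2 (hx.trans_le (le_marg1 ha h.summable x)).ne'
  have hcard0 : 0 < S.card := by
    obtain ⟨x, hx⟩ : ∃ x, 0 < a x := by
      by_contra! hcon
      exact hA.not_ge (hasSum_le hcon h hasSum_zero)
    exact Finset.card_pos.2 ⟨_, hin x hx⟩
  have hcard0' : (0 : ℝ) < S.card := by exact_mod_cast hcard0
  obtain ⟨f, hf, hfl, hfx⟩ := exists_majorant_log_div_marg1 ha h hA
    (w := fun i => if i ∈ S then (1 : ℝ) else 0)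
    (fun i => by positivity) hW hcard0' (fun x hx => by simp [hin x hx])
  have hle : ∀ x, miTerm a x ≤ f x := fun x => by
    refine le_trans ?_ (hfx x)
    rw [miTerm_eq]
    rcases (ha x).eq_or_lt with h0 | h0
    · simp [← h0]
    · have a1 := h0.trans_le (le_marg1 ha h.summable x)
      have a2 := h0.trans_le (le_marg2 ha h.summable x)
      refine mul_le_mul_of_nonneg_left (Real.log_le_log (div_pos h0 (mul_pos a1 a2)) ?_) h0.le
      rw [if_pos (hin x h0), div_le_div_iff₀ (mul_pos a1 a2) a1]
      nlinarith [le_marg2 ha h.summable x]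
  have hs := summable_miTerm_of_le ha h.summable hf hle
  refine ⟨hs, (hs.tsum_le_tsum hle hf).trans (hfl.trans ?_)⟩
  rw [Real.log_div hcard0'.ne' hA.ne', mul_sub]
  have := Real.log_le_log hcard0' (by exact_mod_cast hcard : (S.card : ℝ) ≤ m)
  gcongr

lemma mutInf_of_summable (h : Summable (miTerm a)) :
    mutInf a = ((∑' x, miTerm a x : ℝ) : EReal) := by
  rw [mutInf, if_pos h]

lemma hasSum_max_sub_zero {p q : ℕ × ℕ → ℝ} (hp : HasSum p A) (hq : HasSum q A) :
    HasSum (fun x => max (p x - q x) 0) (TVd p q) := by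
  have hd := hp.sub hq
  have h := ((hd.summable.abs.hasSum).add hd).mul_left (1 / 2)
  rw [sub_self, add_zero] at h
  refine h.congr_fun fun x => ?_
  rcases le_total (p x - q x) 0 with h | h
  · rw [max_eq_right h, abs_of_nonpos h]; ring
  · rw [max_eq_left h, abs_of_nonneg h]; ring

lemma TVd_comm {α : Type*} (p q : α → ℝ) : TVd p q = TVd q p := by
  simp only [TVd, abs_sub_comm]

lemma eq_of_TVd_eq_zero {p q : ℕ × ℕ → ℝ} (hp : HasSum p A) (hq : HasSum q A)
    (h : TVd p q = 0) : p = q := by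
  have h1 := hasSum_max_sub_zero hp hq
  have h2 := hasSum_max_sub_zero hq hp
  rw [TVd_comm] at h2
  rw [h, hasSum_zero_iff_of_nonneg fun x => le_max_right _ _] at h1 h2
  funext x
  have e1 := congrFun h1 x
  have e2 := congrFun h2 x
  simp only [Pi.zero_apply, max_eq_right_iff] at e1 e2
  linarith

end MutualInformation

/-- **One-sided continuity bound for the classical mutual information under a
rank constraint on the first marginal of the first distribution only**: if `p₁`
has at most `m ≥ 1` nonzero entries, then `I(p) ≤ ln m` and for any probability
distribution `q` on `ℕ×ℕ` with `TV(p,q) ≤ ε ≤ 1`,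
`I(p) − I(q) ≤ ε·ln m + 2·g(ε)` in the extended reals. -/
theorem mutInf_rank_one_side_bound
    (p : ℕ × ℕ → ℝ) (hp : IsProbDist p)
    (m : ℕ) (hm : 1 ≤ m)
    (hsupp : (Function.support (marg1 p)).encard ≤ m)
    (q : ℕ × ℕ → ℝ) (hq : IsProbDist q)
    (ε : ℝ) (hε0 : 0 < ε) (hε1 : ε ≤ 1) (hTV : TVd p q ≤ ε) :
    mutInf p ≤ ((Real.log m : ℝ) : EReal) ∧
    mutInf p - mutInf q ≤ ((ε * Real.log m + 2 * gFun ε : ℝ) : EReal) := by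
  obtain ⟨hp0, hp1⟩ := hp
  obtain ⟨hq0, hq1⟩ := hq
  obtain ⟨hsp, hIp⟩ := tsum_miTerm_le_of_encard_support_le hp0 hp1 one_pos hm hsupp
  have hlogm : 0 ≤ Real.log m := Real.log_natCast_nonneg m
  refine ⟨?_, ?_⟩
  · rw [mutInf_of_summable hsp]
    simpa using hIp
  by_cases hsq : Summable (miTerm q)
  swap
  · rw [mutInf_of_summable hsp, mutInf, if_neg hsq, EReal.sub_top]
    exact bot_le
  rw [mutInf_of_summable hsp, mutInf_of_summable hsq, ← EReal.coe_sub, EReal.coe_le_coe_iff]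
  have hu := hasSum_max_sub_zero hp1 hq1
  have hv := hasSum_max_sub_zero hq1 hp1
  rw [TVd_comm q p] at hv
  set δ := TVd p q with hδ
  have hδ0 : 0 ≤ δ := hu.nonneg fun _ => le_max_right _ _
  rcases hδ0.eq_or_lt with h0 | hδpos
  · rw [eq_of_TVd_eq_zero hp1 hq1 (hδ.symm.trans h0.symm), sub_self]
    have := gFun_nonneg hε0.le
    positivity
  set u : ℕ × ℕ → ℝ := fun x => max (p x - q x) 0 with hu_def
  set v : ℕ × ℕ → ℝ := fun x => max (q x - p x) 0 with hv_def
  have hu0 : ∀ x, 0 ≤ u x := fun x => le_max_right _ _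
  have hv0 : ∀ x, 0 ≤ v x := fun x => le_max_right _ _
  have huv : p + v = q + u := by
    funext x
    simp only [Pi.add_apply, hu_def, hv_def]
    rcases le_total (p x) (q x) with h | h
    · rw [max_eq_left (by linarith), max_eq_right (by linarith)]; ring
    · rw [max_eq_right (by linarith), max_eq_left (by linarith)]; ring
  have hup : ∀ x, u x ≤ p x := fun x => max_le (by linarith [hq0 x]) (hp0 x)
  have hsuppu : (Function.support (marg1 u)).encard ≤ m := by
    refine (Set.encard_le_encard fun i hi => ?_).trans hsupp
    have h1 : 0 < marg1 u i := (marg1_nonneg hu0 i).lt_of_ne' hi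
    exact (h1.trans_le (marg1_mono hup hu.summable hp1.summable i)).ne'
  obtain ⟨hsu, hIu⟩ := tsum_miTerm_le_of_encard_support_le hu0 hu hδpos hm hsuppu
  have hle := miTerm_add_le hq0 hu0 hq1.summable hu.summable
  have hsr : Summable (miTerm (q + u)) := summable_miTerm_of_le
    (fun x => add_nonneg (hq0 x) (hu0 x)) (hq1.summable.add hu.summable) (hsq.add hsu) hle
  have hupper := hasSum_le hle hsr.hasSum (hsq.hasSum.add hsu.hasSum)
  obtain ⟨hsv, hlower⟩ := tsum_miTerm_add_tsum_miTerm_le hp0 hv0 hp1 hv one_pos hδpos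
    (huv ▸ hsr) hsp
  rw [huv] at hlower
  have hIv := neg_mul_log_le_tsum_miTerm hv0 hv hδpos hsv
  have hg : 1 * Real.log ((1 + δ) / 1) + δ * Real.log ((1 + δ) / δ) = gFun δ := by
    rw [div_one, Real.log_div (by positivity) hδpos.ne', gFun, add_comm δ 1]
    ring
  rw [hg] at hlower
  have hmono := gFun_monotoneOn (Set.mem_Ici.2 hδ0) (Set.mem_Ici.2 hε0.le) hTV
  have := mul_le_mul_of_nonneg_right hTV hlogm
  linarith
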